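/- arXiv:1905.01873 — 2 statements merged into one kernel-verified Lean document; each statement's English description precedes it below -/
import Mathlib

section
/- For every ρ ∈ ℕ and every τ ∈ ℕ with τ ≥ 1, the set ℱ^ρ_τ of well-labeled forests with τ trees and ρ+τ+1 elements has the same cardinality as the set 𝒟⁻¹_{3,3ρ+τ,ρ} of binary words of length 4ρ+τ with exactly 3ρ+τ letters 0 and ρ letters 1 whose reversal is 3-dominating. -/
/-- A binary word (list of Booleans, `false` = letter 0, `true` = letter 1) is
`k`-dominating if every nonempty prefix contains strictly more than `k` times as
many 0's as 1's. -/
def Dominating (k : ℕ) (w : List Bool) : Prop :=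
  ∀ i ∈ Finset.Icc 1 w.length,
    k * ((w.take i).count true) < (w.take i).count false

/-- `𝒟⁻¹_{k,p,q}` : binary words with `p` letters 0 and `q` letters 1 whose
reversal is `k`-dominating. -/
def DInv (k p q : ℕ) : Set (List Bool) :=
  {w | w.length = p + q ∧ w.count false = p ∧ w.count true = q ∧
    Dominating k w.reverse}

/-- A forest with `t` trees: a set of finite nonempty sequences of positive
integers such that (1) the length-one sequences are exactly `[1], …, [t+1]`;
(2) it is closed under taking parents (deleting the last entry); (3) for each
element `u` there is `c_u ∈ ℕ` such that `u·i` belongs to the forest iff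
`i ≤ c_u`; (4) the floor `t+1` has no child. -/
def IsForest (F : Finset (List ℕ+)) (t : ℕ) : Prop :=
  ([] : List ℕ+) ∉ F ∧
  (∀ i : ℕ+, [i] ∈ F ↔ (i : ℕ) ≤ t + 1) ∧
  (∀ u ∈ F, 2 ≤ u.length → u.dropLast ∈ F) ∧
  (∀ u ∈ F, ∃ c : ℕ, ∀ i : ℕ+, (u ++ [i] ∈ F ↔ (i : ℕ) ≤ c)) ∧
  (∀ i : ℕ+, [Nat.succPNat t, i] ∉ F)

/-- A well-labeling of a forest `F`: floors get label 0, length-2 elements get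
label −1, and for every non-floor element `u`, the labels of its children form a
nondecreasing sequence lying between `ℓ(u) − 1` and `ℓ(u) + 1`. -/
def IsWellLabeled (F : Finset (List ℕ+)) (ℓ : {u : List ℕ+ // u ∈ F} → ℤ) : Prop :=
  (∀ (u : List ℕ+) (h : u ∈ F), u.length = 1 → ℓ ⟨u, h⟩ = 0) ∧
  (∀ (u : List ℕ+) (h : u ∈ F), u.length = 2 → ℓ ⟨u, h⟩ = -1) ∧
  (∀ (u : List ℕ+) (hu : u ∈ F), 2 ≤ u.length →
    ∀ (i : ℕ+) (hi : u ++ [i] ∈ F),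
      ℓ ⟨u, hu⟩ - 1 ≤ ℓ ⟨u ++ [i], hi⟩ ∧ ℓ ⟨u ++ [i], hi⟩ ≤ ℓ ⟨u, hu⟩ + 1) ∧
  (∀ (u : List ℕ+), u ∈ F → 2 ≤ u.length →
    ∀ i j : ℕ+, i ≤ j →
      ∀ (hi : u ++ [i] ∈ F) (hj : u ++ [j] ∈ F),
        ℓ ⟨u ++ [i], hi⟩ ≤ ℓ ⟨u ++ [j], hj⟩)

/-- `ℱ^ρ_τ` : well-labeled forests with `τ` trees and `ρ + τ + 1` elements. -/
def WellLabeledForests (ρ τ : ℕ) :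
    Set (Σ F : Finset (List ℕ+), {u : List ℕ+ // u ∈ F} → ℤ) :=
  {x | IsForest x.1 τ ∧ x.1.card = ρ + τ + 1 ∧ IsWellLabeled x.1 x.2}

/-! ### Dominating words -/

theorem dominating_append_singleton (k : ℕ) (w : List Bool) (b : Bool) :
    Dominating k (w ++ [b]) ↔
      Dominating k w ∧ k * (w ++ [b]).count true < (w ++ [b]).count false := by
  constructor
  · intro h
    refine ⟨fun i hi => ?_, ?_⟩
    · rw [Finset.mem_Icc] at hi
      have := h i (by simp; omega)
      rwa [List.take_append_of_le_length hi.2] at this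
    · have := h (w ++ [b]).length (by simp)
      rwa [List.take_length] at this
  · rintro ⟨h, h'⟩ i hi
    rw [Finset.mem_Icc] at hi
    by_cases hiw : i ≤ w.length
    · rw [List.take_append_of_le_length hiw]
      exact h i (by simp; omega)
    · rw [List.take_of_length_le (by simp; omega)]
      exact h'

theorem cons_mem_dInv_iff {k p q : ℕ} {b : Bool} {w : List Bool} (h : k * q < p) :
    b :: w ∈ DInv k p q ↔
      w.count false + (if b then 0 else 1) = p ∧ w.count true + (if b then 1 else 0) = q ∧
        Dominating k w.reverse := by
  have hlen := List.count_false_add_count_true w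
  simp only [DInv, Set.mem_ofPred_eq, List.reverse_cons, dominating_append_singleton,
    List.length_cons, List.count_cons, List.count_append, List.count_reverse]
  cases b <;> simp <;> constructor
  · rintro ⟨_, h1, h2, h3, _⟩
    exact ⟨h1, h2, h3⟩
  · rintro ⟨h1, h2, h3⟩
    exact ⟨by omega, h1, h2, h3, by rw [h2]; omega⟩
  · rintro ⟨_, h1, h2, h3, _⟩
    exact ⟨h1, h2, h3⟩
  · rintro ⟨h1, h2, h3⟩
    exact ⟨by omega, h1, h2, h3, by rw [h2, h1]; exact h⟩

theorem mem_dInv_iff {k p q : ℕ} {w : List Bool} :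
    w ∈ DInv k p q ↔ w.count false = p ∧ w.count true = q ∧ Dominating k w.reverse := by
  have hlen := List.count_false_add_count_true w
  simp only [DInv, Set.mem_ofPred_eq]
  constructor
  · rintro ⟨_, h⟩
    exact h
  · rintro ⟨h1, h2, h3⟩
    exact ⟨by omega, h1, h2, h3⟩

theorem nil_notMem_dInv {k p q : ℕ} (h : k * q < p) : [] ∉ DInv k p q := by
  rw [mem_dInv_iff]
  simp
  omega

theorem dInv_zero_zero (k : ℕ) : DInv k 0 0 = {[]} := by
  ext w
  rw [Set.mem_singleton_iff]
  constructor
  · rintro ⟨h, -⟩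
    simpa using h
  · rintro rfl
    simp [mem_dInv_iff, Dominating]

theorem dInv_mul_succ_eq_empty (k q : ℕ) : DInv k (k * (q + 1)) (q + 1) = ∅ := by
  rw [Set.eq_empty_iff_forall_notMem]
  rintro w ⟨hl, h0, h1, hd⟩
  have := hd w.reverse.length (by simp; omega)
  rw [List.take_length] at this
  simp [h0, h1] at this

theorem encard_dInv_succ_zero (k p : ℕ) :
    (DInv k (p + 1) 0).encard = (DInv k p 0).encard := by
  have h : DInv k (p + 1) 0 = List.cons false '' DInv k p 0 := by
    ext w
    rcases w with _ | ⟨b, w⟩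
    · simpa using nil_notMem_dInv (by simp)
    · rw [cons_mem_dInv_iff (by simp)]
      cases b <;> simp [mem_dInv_iff]
  rw [h, List.cons_injective.encard_image]

theorem encard_dInv_succ_succ (k p q : ℕ) (h : k * (q + 1) < p + 1) :
    (DInv k (p + 1) (q + 1)).encard =
      (DInv k p (q + 1)).encard + (DInv k (p + 1) q).encard := by
  have h : DInv k (p + 1) (q + 1) =
      List.cons false '' DInv k p (q + 1) ∪ List.cons true '' DInv k (p + 1) q := by
    ext w
    rcases w with _ | ⟨b, w⟩
    · simpa using nil_notMem_dInv h
    · rw [cons_mem_dInv_iff h]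
      cases b <;> simp [mem_dInv_iff]
  rw [h, Set.encard_union_eq, List.cons_injective.encard_image, List.cons_injective.encard_image]
  rw [Set.disjoint_left]
  rintro _ ⟨v, -, rfl⟩ ⟨w, -, hw⟩
  simp at hw

/-! ### Labeled forests with labels extended to all sequences -/

/-- The largest label allowed for a child of `u`. -/
def maxChildLabel (ℓ : List ℕ+ → ℤ) (u : List ℕ+) : ℤ :=
  if u.length = 1 then -1 else ℓ u + 1

/-- `F` is a forest with `t` trees, well-labeled by the restriction of `ℓ`, where `ℓ` vanishes
outside of `F`. -/
structure IsLabeledForest (t : ℕ) (F : Finset (List ℕ+)) (ℓ : List ℕ+ → ℤ) : Prop where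
  isForest : IsForest F t
  isWellLabeled : IsWellLabeled F (fun u => ℓ u)
  eq_zero_of_notMem : ∀ u ∉ F, ℓ u = 0

namespace IsLabeledForest

variable {t : ℕ} {F : Finset (List ℕ+)} {ℓ : List ℕ+ → ℤ}

theorem ne_nil (h : IsLabeledForest t F ℓ) {u : List ℕ+} (hu : u ∈ F) : u ≠ [] := by
  rintro rfl
  exact h.isForest.1 hu

theorem one_le_length (h : IsLabeledForest t F ℓ) {u : List ℕ+} (hu : u ∈ F) :
    1 ≤ u.length :=
  List.length_pos_iff.2 (h.ne_nil hu)

theorem mem_of_append_mem (h : IsLabeledForest t F ℓ) {u : List ℕ+} {i : ℕ+} (hu : u ≠ [])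
    (hi : u ++ [i] ∈ F) : u ∈ F := by
  have := h.isForest.2.2.1 _ hi (by
    have := List.length_pos_iff.2 hu
    simp; omega)
  simpa using this

theorem label_le (h : IsLabeledForest t F ℓ) {u : List ℕ+} {i : ℕ+} (hu : u ∈ F)
    (hi : u ++ [i] ∈ F) : ℓ (u ++ [i]) ≤ maxChildLabel ℓ u := by
  have hl := h.one_le_length hu
  unfold maxChildLabel
  split_ifs with h1
  · exact (h.isWellLabeled.2.1 _ hi (by simp [h1])).le
  · exact (h.isWellLabeled.2.2.1 u hu (by omega) i hi).2

theorem label_mono (h : IsLabeledForest t F ℓ) {u : List ℕ+} {i j : ℕ+} (hu : u ∈ F)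
    (hij : i ≤ j) (hi : u ++ [i] ∈ F) (hj : u ++ [j] ∈ F) :
    ℓ (u ++ [i]) ≤ ℓ (u ++ [j]) := by
  have hl := h.one_le_length hu
  by_cases h1 : u.length = 1
  · have h2 := h.isWellLabeled.2.1 _ hi (by simp [h1])
    have h3 := h.isWellLabeled.2.1 _ hj (by simp [h1])
    simp only at h2 h3
    omega
  · exact h.isWellLabeled.2.2.2 u hu (by omega) i j hij hi hj

theorem exists_next_child (h : IsLabeledForest t F ℓ) {u : List ℕ+} (hu : u ∈ F) :
    ∃ i : ℕ+, ∀ j, u ++ [j] ∈ F ↔ j < i := by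
  obtain ⟨c, hc⟩ := h.isForest.2.2.2.1 u hu
  refine ⟨Nat.succPNat c, fun j => ?_⟩
  rw [hc, ← PNat.coe_lt_coe, Nat.succPNat_coe]
  omega

theorem mem_of_le (h : IsLabeledForest t F ℓ) {u : List ℕ+} (hu : u ∈ F) {i j : ℕ+}
    (hij : i ≤ j) (hj : u ++ [j] ∈ F) : u ++ [i] ∈ F := by
  obtain ⟨k, hk⟩ := h.exists_next_child hu
  rw [hk] at hj ⊢
  exact hij.trans_lt hj

/-- Adding a next child keeps the forest well-labeled. -/
theorem insert_child (h : IsLabeledForest t F ℓ) {u : List ℕ+} (hu : u ∈ F) {i : ℕ+}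
    (hi : ∀ j, u ++ [j] ∈ F ↔ j < i) (hut : u ≠ [Nat.succPNat t]) {a : ℤ}
    (hle : ∀ j, u ++ [j] ∈ F → ℓ (u ++ [j]) ≤ a) (ha : a ≤ maxChildLabel ℓ u)
    (ha' : maxChildLabel ℓ u - 2 ≤ a) (ha1 : u.length = 1 → a = -1) :
    IsLabeledForest t (insert (u ++ [i]) F) (Function.update ℓ (u ++ [i]) a) := by
  have hl := h.one_le_length hu
  have hnot : u ++ [i] ∉ F := by simp [hi]
  have hdesc : ∀ j, u ++ [i] ++ [j] ∉ F := fun j hj =>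
    hnot (h.mem_of_append_mem (by simp) hj)
  have hne : ∀ v ∈ F, v ≠ u ++ [i] := fun v hv hv' => hnot (hv' ▸ hv)
  have hself : ∀ (v : List ℕ+) (j : ℕ+), v ++ [j] ≠ v := by simp
  refine ⟨⟨?_, ?_, ?_, ?_, ?_⟩, ⟨?_, ?_, ?_, ?_⟩, ?_⟩
  · simp [h.isForest.1]
  · intro j
    rw [Finset.mem_insert, ← h.isForest.2.1]
    refine ⟨fun h' => h'.resolve_left fun h' => ?_, Or.inr⟩
    have := congrArg List.length h'
    simp only [List.length_append, List.length_singleton] at this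
    omega
  · intro v hv hv2
    rw [Finset.mem_insert] at hv ⊢
    rcases hv with rfl | hv
    · right
      simpa using hu
    · exact Or.inr (h.isForest.2.2.1 v hv hv2)
  · intro v hv
    rw [Finset.mem_insert] at hv
    by_cases hvu : v = u
    · subst hvu
      refine ⟨i, fun j => ?_⟩
      rw [Finset.mem_insert, hi, PNat.coe_le_coe, le_iff_eq_or_lt]
      simp
    · have key : ∀ j, v ++ [j] ∈ insert (u ++ [i]) F ↔ v ++ [j] ∈ F := by
        intro j
        rw [Finset.mem_insert]
        refine ⟨fun h' => h'.resolve_left fun h' => hvu ?_, Or.inr⟩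
        exact (List.append_inj' h' rfl).1
      simp only [key]
      rcases hv with rfl | hv
      · refine ⟨0, fun j => ?_⟩
        simp only [hdesc, false_iff]
        have := j.pos
        omega
      · exact h.isForest.2.2.2.1 v hv
  · intro j
    rw [Finset.mem_insert, not_or]
    refine ⟨fun h' => hut ?_, h.isForest.2.2.2.2 j⟩
    exact (List.append_inj' (s₁ := [Nat.succPNat t]) (t₁ := [j]) h' rfl).1.symm
  · intro v hv hv1
    rw [Finset.mem_insert] at hv
    rcases hv with rfl | hv
    · simp only [List.length_append, List.length_singleton] at hv1
      omega
    · simp only [Function.update_of_ne (hne v hv)]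
      exact h.isWellLabeled.1 v hv hv1
  · intro v hv hv2
    rw [Finset.mem_insert] at hv
    rcases hv with rfl | hv
    · simp only [List.length_append, List.length_singleton] at hv2
      simpa using ha1 (by omega)
    · simp only [Function.update_of_ne (hne v hv)]
      exact h.isWellLabeled.2.1 v hv hv2
  · intro v hv hv2 j hj
    rw [Finset.mem_insert] at hv hj
    rcases hv with rfl | hv
    · exact absurd (hj.resolve_left (hself _ j)) (hdesc j)
    · simp only [Function.update_of_ne (hne v hv)]
      rcases hj with hj | hj
      · obtain ⟨rfl, -⟩ := List.append_inj' hj rfl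
        rw [hj, Function.update_self]
        simp only [maxChildLabel, show ¬ v.length = 1 by omega, if_false] at ha ha'
        omega
      · simp only [Function.update_of_ne (hne _ hj)]
        exact h.isWellLabeled.2.2.1 v hv hv2 j hj
  · intro v hv hv2 j k hjk hj hk
    rw [Finset.mem_insert] at hv hj hk
    rcases hv with rfl | hv
    · exact absurd (hj.resolve_left (hself _ j)) (hdesc j)
    · rcases hk with hk | hk
      · rcases hj with hj' | hj'
        · simp only [hj', hk, le_refl]
        · simp only [hk, Function.update_self, Function.update_of_ne (hne _ hj')]
          obtain ⟨rfl, -⟩ := List.append_inj' hk rfl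
          exact hle j hj'
      · have hj' := h.mem_of_le hv hjk hk
        simp only [Function.update_of_ne (hne _ hj'), Function.update_of_ne (hne _ hk)]
        exact h.isWellLabeled.2.2.2 v hv hv2 j k hjk hj' hk
  · intro v hv
    rw [Finset.mem_insert, not_or] at hv
    rw [Function.update_of_ne hv.1]
    exact h.eq_zero_of_notMem v hv.2

end IsLabeledForest

/-! ### Completions of partial labeled forests -/

/-- A labeled forest under construction: `r u` is the number of labels still available for the new
children of `u ∈ F`. -/
structure IsPartial (t : ℕ) (F : Finset (List ℕ+)) (ℓ : List ℕ+ → ℤ) (r : List ℕ+ → ℕ) :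
    Prop where
  isLabeledForest : IsLabeledForest t F ℓ
  le_three : ∀ u ∈ F, r u ≤ 3
  le_one : ∀ u ∈ F, u.length = 1 → r u ≤ 1
  last_floor : r [Nat.succPNat t] = 0
  label_le : ∀ u ∈ F, ∀ i, u ++ [i] ∈ F → ℓ (u ++ [i]) + r u ≤ maxChildLabel ℓ u + 1

/-- The labeled forests with `N` elements that extend `(F, ℓ)`, in which each new child of
`u ∈ F` carries one of the `r u` largest allowed labels. -/
def completions (t N : ℕ) (F : Finset (List ℕ+)) (ℓ : List ℕ+ → ℤ) (r : List ℕ+ → ℕ) :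
    Set (Finset (List ℕ+) × (List ℕ+ → ℤ)) :=
  {x | IsLabeledForest t x.1 x.2 ∧ x.1.card = N ∧ F ⊆ x.1 ∧ (∀ u ∈ F, x.2 u = ℓ u) ∧
    ∀ u ∈ F, ∀ i, u ++ [i] ∈ x.1 → u ++ [i] ∉ F →
      maxChildLabel ℓ u < x.2 (u ++ [i]) + r u}

variable {t N : ℕ} {F : Finset (List ℕ+)} {ℓ : List ℕ+ → ℤ} {r : List ℕ+ → ℕ}

theorem completions_eq_empty_of_lt_card (h : N < F.card) : completions t N F ℓ r = ∅ := by
  rw [Set.eq_empty_iff_forall_notMem]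
  rintro x ⟨-, hN, hF, -⟩
  have := Finset.card_le_card hF
  omega

theorem eq_of_mem_completions (h : IsLabeledForest t F ℓ) (hr : ∀ u ∈ F, r u = 0)
    {x : Finset (List ℕ+) × (List ℕ+ → ℤ)} (hx : x ∈ completions t N F ℓ r) :
    x = (F, ℓ) := by
  obtain ⟨hx, -, hF, hℓ, hnew⟩ := hx
  have hsub : ∀ v, v ∈ x.1 → v ∈ F := by
    intro v
    induction v using List.reverseRecOn with
    | nil => exact fun hv => absurd hv hx.isForest.1
    | append_singleton w k ih =>
      intro hv
      by_cases hw : w = []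
      · subst hw
        exact (h.isForest.2.1 k).2 ((hx.isForest.2.1 k).1 hv)
      · have hwx := hx.mem_of_append_mem hw hv
        have hwF := ih hwx
        by_contra hvF
        have h1 := hnew w hwF k hv hvF
        have h2 := hx.label_le hwx hv
        have h3 : maxChildLabel x.2 w = maxChildLabel ℓ w := by
          simp only [maxChildLabel, hℓ w hwF]
        rw [hr w hwF] at h1
        push_cast at h1
        omega
  have hxF : x.1 = F := Finset.Subset.antisymm hsub hF
  refine Prod.ext hxF (funext fun v => ?_)
  by_cases hv : v ∈ F
  · exact hℓ v hv
  · exact (hx.eq_zero_of_notMem v (hxF ▸ hv)).trans (h.eq_zero_of_notMem v hv).symm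

theorem mem_completions_self (h : IsLabeledForest t F ℓ) :
    (F, ℓ) ∈ completions t F.card F ℓ r :=
  ⟨h, rfl, subset_rfl, fun _ _ => rfl, fun _ _ _ hi hi' => absurd hi hi'⟩

theorem IsPartial.update_remaining (h : IsPartial t F ℓ r) {u : List ℕ+} {m : ℕ}
    (hr : r u = m + 1) : IsPartial t F ℓ (Function.update r u m) := by
  have hle : ∀ v, Function.update r u m v ≤ r v := by
    intro v
    by_cases hv : v = u
    · subst hv
      simp [hr]
    · simp [hv]
  refine ⟨h.isLabeledForest, fun v hv => (hle v).trans (h.le_three v hv),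
    fun v hv h1 => (hle v).trans (h.le_one v hv h1),
    Nat.le_zero.1 ((hle _).trans h.last_floor.le), fun v hv i hi => ?_⟩
  have h1 := h.label_le v hv i hi
  have h2 := hle v
  omega

section Step

variable {u : List ℕ+} {m : ℕ} {i : ℕ+}

theorem IsPartial.insert_child (h : IsPartial t F ℓ r) (hu : u ∈ F) (hr : r u = m + 1)
    (hi : ∀ j, u ++ [j] ∈ F ↔ j < i) :
    IsPartial t (insert (u ++ [i]) F)
      (Function.update ℓ (u ++ [i]) (maxChildLabel ℓ u - m))
      (Function.update r (u ++ [i]) 3) := by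
  have hF := h.isLabeledForest
  have hl := hF.one_le_length hu
  have hnot : u ++ [i] ∉ F := by simp [hi]
  have hdesc : ∀ j, u ++ [i] ++ [j] ∉ F := fun j hj =>
    hnot (hF.mem_of_append_mem (by simp) hj)
  have hne : ∀ v ∈ F, v ≠ u ++ [i] := fun v hv hv' => hnot (hv' ▸ hv)
  have hmax : ∀ v ∈ F, maxChildLabel
      (Function.update ℓ (u ++ [i]) (maxChildLabel ℓ u - m)) v = maxChildLabel ℓ v := by
    intro v hv
    simp only [maxChildLabel, Function.update_of_ne (hne v hv)]
  refine ⟨hF.insert_child hu hi ?_ ?_ ?_ ?_ ?_, ?_, ?_, ?_, ?_⟩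
  · rintro rfl
    have := h.last_floor
    omega
  · intro j hj
    have := h.label_le u hu j hj
    rw [hr] at this
    push_cast at this
    omega
  · omega
  · have := h.le_three u hu
    omega
  · intro h1
    have := h.le_one u hu h1
    rw [maxChildLabel, if_pos h1]
    omega
  · intro v hv
    rcases Finset.mem_insert.1 hv with rfl | hv
    · simp
    · simpa only [Function.update_of_ne (hne v hv)] using h.le_three v hv
  · intro v hv h1
    rcases Finset.mem_insert.1 hv with rfl | hv
    · simp only [List.length_append, List.length_singleton] at h1
      omega
    · simpa only [Function.update_of_ne (hne v hv)] using h.le_one v hv h1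
  · rw [Function.update_of_ne, h.last_floor]
    intro h'
    have := congrArg List.length h'
    simp only [List.length_append, List.length_singleton] at this
    omega
  · intro v hv j hj
    rcases Finset.mem_insert.1 hv with rfl | hv
    · exact absurd ((Finset.mem_insert.1 hj).resolve_left (by simp)) (hdesc j)
    · rw [hmax v hv, Function.update_of_ne (hne v hv)]
      rcases Finset.mem_insert.1 hj with hj | hj
      · obtain ⟨rfl, -⟩ := List.append_inj' hj rfl
        rw [hj, Function.update_self, hr]
        push_cast
        omega
      · rw [Function.update_of_ne (hne _ hj)]
        exact h.label_le v hv j hj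

theorem completions_eq_union (h : IsPartial t F ℓ r) (hu : u ∈ F) (hr : r u = m + 1)
    (hi : ∀ j, u ++ [j] ∈ F ↔ j < i) :
    completions t N F ℓ r =
      completions t N F ℓ (Function.update r u m) ∪
      completions t N (insert (u ++ [i]) F)
        (Function.update ℓ (u ++ [i]) (maxChildLabel ℓ u - m))
        (Function.update r (u ++ [i]) 3) := by
  have hF := h.isLabeledForest
  have hnot : u ++ [i] ∉ F := by simp [hi]
  have hne : ∀ v ∈ F, v ≠ u ++ [i] := fun v hv hv' => hnot (hv' ▸ hv)
  have hmax : ∀ v ∈ F, maxChildLabel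
      (Function.update ℓ (u ++ [i]) (maxChildLabel ℓ u - m)) v = maxChildLabel ℓ v := by
    intro v hv
    simp only [maxChildLabel, Function.update_of_ne (hne v hv)]
  ext x
  constructor
  · rintro ⟨hx, hN, hsub, hℓ, hnew⟩
    have hlen : 2 ≤ (u ++ [i]).length := by
      have := hF.one_le_length hu
      simp only [List.length_append, List.length_singleton]
      omega
    by_cases hc : u ++ [i] ∈ x.1 ∧ x.2 (u ++ [i]) = maxChildLabel ℓ u - m
    · right
      refine ⟨hx, hN, Finset.insert_subset hc.1 hsub, fun v hv => ?_, fun v hv j hj hj' => ?_⟩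
      · rcases Finset.mem_insert.1 hv with rfl | hv
        · rw [hc.2, Function.update_self]
        · rw [Function.update_of_ne (hne v hv), hℓ v hv]
      · rw [Finset.mem_insert, not_or] at hj'
        rcases Finset.mem_insert.1 hv with rfl | hv
        · rw [maxChildLabel, if_neg (by omega),
            Function.update_self, Function.update_self, ← hc.2]
          have := (hx.isWellLabeled.2.2.1 _ hc.1 hlen j hj).1
          dsimp only at this
          push_cast
          omega
        · rw [hmax v hv, Function.update_of_ne (hne v hv)]
          exact hnew v hv j hj hj'.2
    · left
      refine ⟨hx, hN, hsub, hℓ, fun v hv j hj hj' => ?_⟩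
      have h1 := hnew v hv j hj hj'
      by_cases hvu : v = u
      · subst hvu
        have hij : i ≤ j := not_lt.1 fun hlt => hj' ((hi j).2 hlt)
        have hix := hx.mem_of_le (hsub hv) hij hj
        have h2 := hx.label_mono (hsub hv) hij hix hj
        have h3 := hnew v hv i hix hnot
        have h4 : x.2 (v ++ [i]) ≠ maxChildLabel ℓ v - m := fun h4 => hc ⟨hix, h4⟩
        rw [Function.update_self]
        rw [hr] at h3
        push_cast at h3
        omega
      · rwa [Function.update_of_ne hvu]
  · rintro (⟨hx, hN, hsub, hℓ, hnew⟩ | ⟨hx, hN, hsub, hℓ, hnew⟩)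
    · refine ⟨hx, hN, hsub, hℓ, fun v hv j hj hj' => ?_⟩
      have h1 := hnew v hv j hj hj'
      by_cases hvu : v = u
      · subst hvu
        rw [Function.update_self] at h1
        rw [hr]
        push_cast
        omega
      · rwa [Function.update_of_ne hvu] at h1
    · have hsub' := fun v hv => Finset.mem_insert_of_mem (b := u ++ [i]) (a := v) (s := F) hv
      refine ⟨hx, hN, fun v hv => hsub (hsub' v hv), fun v hv => ?_, fun v hv j hj hj' => ?_⟩
      · rw [hℓ v (hsub' v hv), Function.update_of_ne (hne v hv)]
      · by_cases hvj : v ++ [j] = u ++ [i]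
        · obtain ⟨rfl, -⟩ := List.append_inj' hvj rfl
          rw [hvj, hℓ _ (Finset.mem_insert_self _ _), Function.update_self, hr]
          push_cast
          omega
        · have h1 := hnew v (hsub' v hv) j hj fun hmem =>
            hj' ((Finset.mem_insert.1 hmem).resolve_left hvj)
          rwa [hmax v hv, Function.update_of_ne (hne v hv)] at h1

theorem disjoint_completions (hu : u ∈ F) (hi : ∀ j, u ++ [j] ∈ F ↔ j < i) :
    Disjoint (completions t N F ℓ (Function.update r u m))
      (completions t N (insert (u ++ [i]) F)
        (Function.update ℓ (u ++ [i]) (maxChildLabel ℓ u - m))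
        (Function.update r (u ++ [i]) 3)) := by
  rw [Set.disjoint_left]
  rintro x ⟨-, -, -, -, hnew⟩ ⟨-, -, hsub, hℓ, -⟩
  have hv := Finset.mem_insert_self (u ++ [i]) F
  have h1 := hnew u hu i (hsub hv) (by simp [hi])
  have h2 := hℓ _ hv
  rw [Function.update_self] at h1 h2
  omega

end Step

theorem encard_completions (ρ s : ℕ) (h : IsPartial t F ℓ r) (hs : ∑ u ∈ F, r u = s) :
    (completions t (F.card + ρ) F ℓ r).encard = (DInv 3 (3 * ρ + s) ρ).encard := by
  obtain ⟨n, hn⟩ : ∃ n, 4 * ρ + s = n := ⟨_, rfl⟩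
  induction n using Nat.strong_induction_on generalizing ρ s F ℓ r with
  | _ n ih =>
  have hF := h.isLabeledForest
  rcases s with _ | s
  · have hr : ∀ u ∈ F, r u = 0 := Finset.sum_eq_zero_iff.1 hs
    rcases ρ with _ | ρ
    · have : completions t (F.card + 0) F ℓ r = {(F, ℓ)} :=
        Set.eq_singleton_iff_unique_mem.2
          ⟨mem_completions_self hF, fun x hx => eq_of_mem_completions hF hr hx⟩
      rw [this, dInv_zero_zero, Set.encard_singleton, Set.encard_singleton]
    · have : completions t (F.card + (ρ + 1)) F ℓ r = ∅ := by
        rw [Set.eq_empty_iff_forall_notMem]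
        intro x hx
        have hN := hx.2.1
        rw [eq_of_mem_completions hF hr hx] at hN
        simp at hN
      rw [this, add_zero, dInv_mul_succ_eq_empty, Set.encard_empty, Set.encard_empty]
  · obtain ⟨u, hu, hru⟩ : ∃ u ∈ F, r u ≠ 0 := by
      by_contra! hall
      rw [Finset.sum_eq_zero hall] at hs
      omega
    obtain ⟨m, hm⟩ := Nat.exists_eq_succ_of_ne_zero hru
    obtain ⟨i, hi⟩ := hF.exists_next_child hu
    have hnot : u ++ [i] ∉ F := by simp [hi]
    have hs1 : ∑ v ∈ F, Function.update r u m v = s := by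
      rw [Finset.sum_update_of_mem hu]
      rw [Finset.sum_eq_add_sum_sdiff_singleton_of_mem hu] at hs
      omega
    have hs2 : ∑ v ∈ insert (u ++ [i]) F, Function.update r (u ++ [i]) 3 v = s + 4 := by
      rw [Finset.sum_insert hnot, Function.update_self, Finset.sum_update_of_notMem hnot, hs]
      omega
    rw [completions_eq_union h hu hm hi, Set.encard_union_eq (disjoint_completions hu hi),
      ih _ (by omega) ρ s (h.update_remaining hm) hs1 rfl]
    rcases ρ with _ | ρ
    · rw [completions_eq_empty_of_lt_card (F := insert (u ++ [i]) F)
        (by rw [Finset.card_insert_of_notMem hnot]; omega), Set.encard_empty, add_zero,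
        ← add_assoc, encard_dInv_succ_zero]
    · rw [show F.card + (ρ + 1) = (insert (u ++ [i]) F).card + ρ by
          rw [Finset.card_insert_of_notMem hnot]; omega,
        ih _ (by omega) ρ (s + 4) (h.insert_child hu hm hi) hs2 rfl,
        show 3 * ρ + (s + 4) = 3 * (ρ + 1) + s + 1 by omega,
        ← add_assoc (3 * (ρ + 1)) s 1, encard_dInv_succ_succ 3 _ ρ (by omega)]

/-! ### The initial partial forest -/

/-- The `t + 1` floors. -/
def floors (t : ℕ) : Finset (List ℕ+) :=
  (Finset.range (t + 1)).image fun j => [Nat.succPNat j]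

theorem mem_floors {v : List ℕ+} : v ∈ floors t ↔ ∃ i : ℕ+, (i : ℕ) ≤ t + 1 ∧ v = [i] := by
  simp only [floors, Finset.mem_image, Finset.mem_range]
  constructor
  · rintro ⟨j, hj, rfl⟩
    exact ⟨Nat.succPNat j, by simp; omega, rfl⟩
  · rintro ⟨i, hi, rfl⟩
    have := i.pos
    exact ⟨i.natPred, by rw [PNat.natPred]; omega, by simp⟩

theorem floors_injective : Function.Injective fun j : ℕ => [Nat.succPNat j] := by
  intro a b hab
  simpa using hab

theorem card_floors : (floors t).card = t + 1 := by
  rw [floors, Finset.card_image_of_injective _ floors_injective, Finset.card_range]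

theorem isLabeledForest_floors : IsLabeledForest t (floors t) 0 := by
  have hlen : ∀ v ∈ floors t, v.length = 1 := by
    intro v hv
    obtain ⟨i, -, rfl⟩ := mem_floors.1 hv
    rfl
  refine ⟨⟨fun h => by simpa using hlen _ h, fun i => by simp [mem_floors],
    fun v hv hv2 => by have := hlen v hv; omega, fun v hv => ⟨0, fun i => ?_⟩,
    fun i h => by simpa using hlen _ h⟩,
    ⟨fun _ _ _ => rfl, fun v hv hv2 => by have := hlen v hv; omega,
      fun v hv hv2 => by have := hlen v hv; omega,
      fun v hv hv2 => by have := hlen v hv; omega⟩, fun _ _ => rfl⟩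
  have hi := i.pos
  refine ⟨fun h => ?_, fun h => by omega⟩
  have h1 := hlen v hv
  have h2 := hlen _ h
  simp [h1] at h2

theorem isPartial_floors :
    IsPartial t (floors t) 0 fun u => if u = [Nat.succPNat t] then 0 else 1 := by
  refine ⟨isLabeledForest_floors, fun u _ => ?_, fun u _ _ => ?_, if_pos rfl,
    fun u hu i hi => ?_⟩
  · split_ifs <;> omega
  · split_ifs <;> omega
  · obtain ⟨j, -, rfl⟩ := mem_floors.1 hu
    obtain ⟨k, -, hk⟩ := mem_floors.1 hi
    simp at hk

theorem sum_floors : (∑ u ∈ floors t, if u = [Nat.succPNat t] then 0 else 1) = t := by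
  rw [floors, Finset.sum_image floors_injective.injOn, Finset.sum_range_succ, if_pos rfl,
    add_zero, Finset.sum_congr rfl (g := fun _ => 1)]
  · simp
  · intro j hj
    rw [if_neg fun h => (Finset.mem_range.1 hj).ne (floors_injective h)]

theorem completions_floors (N : ℕ) :
    completions t N (floors t) 0 (fun u => if u = [Nat.succPNat t] then 0 else 1) =
      {x | IsLabeledForest t x.1 x.2 ∧ x.1.card = N} := by
  ext x
  refine ⟨fun h => ⟨h.1, h.2.1⟩, fun ⟨hx, hN⟩ => ?_⟩
  have hsub : floors t ⊆ x.1 := by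
    intro v hv
    obtain ⟨i, hi, rfl⟩ := mem_floors.1 hv
    exact (hx.isForest.2.1 i).2 hi
  refine ⟨hx, hN, hsub, fun v hv => ?_, fun v hv j hj _ => ?_⟩
  · obtain ⟨i, hi, rfl⟩ := mem_floors.1 hv
    exact hx.isWellLabeled.1 _ (hsub hv) rfl
  · obtain ⟨i, hi, rfl⟩ := mem_floors.1 hv
    have hlab := hx.isWellLabeled.2.1 _ hj rfl
    dsimp only at hlab ⊢
    rw [hlab, if_neg]
    · simp [maxChildLabel]
    · intro h
      rw [h] at hj
      exact hx.isForest.2.2.2.2 j hj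

theorem wellLabeledForests_eq_image (ρ τ : ℕ) :
    WellLabeledForests ρ τ =
      (fun x : Finset (List ℕ+) × (List ℕ+ → ℤ) =>
        (⟨x.1, fun u => x.2 u⟩ : Σ F : Finset (List ℕ+), {u : List ℕ+ // u ∈ F} → ℤ)) ''
      {x | IsLabeledForest τ x.1 x.2 ∧ x.1.card = ρ + τ + 1} := by
  ext ⟨F, ℓ⟩
  constructor
  · rintro ⟨hF, hN, hℓ⟩
    have hres : (fun u : {u : List ℕ+ // u ∈ F} =>
        if h : (u : List ℕ+) ∈ F then ℓ ⟨u, h⟩ else 0) = ℓ := by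
      funext u
      rw [dif_pos u.2]
    refine ⟨(F, fun u => if h : u ∈ F then ℓ ⟨u, h⟩ else 0),
      ⟨⟨hF, ?_, fun u hu => dif_neg hu⟩, hN⟩, ?_⟩
    · simp only [hres]
      exact hℓ
    · simp only [hres]
  · rintro ⟨⟨F', ℓ'⟩, ⟨hx, hN⟩, heq⟩
    rw [← heq]
    exact ⟨hx.isForest, hN, hx.isWellLabeled⟩

theorem injOn_restrict_isLabeledForest (τ N : ℕ) :
    Set.InjOn (fun x : Finset (List ℕ+) × (List ℕ+ → ℤ) =>
        (⟨x.1, fun u => x.2 u⟩ : Σ F : Finset (List ℕ+), {u : List ℕ+ // u ∈ F} → ℤ))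
      {x | IsLabeledForest τ x.1 x.2 ∧ x.1.card = N} := by
  rintro ⟨F, ℓ⟩ ⟨hx, -⟩ ⟨F', ℓ'⟩ ⟨hy, -⟩ heq
  obtain ⟨rfl, heq⟩ := Sigma.mk.inj heq
  refine Prod.ext rfl (funext fun v => ?_)
  by_cases hv : v ∈ F
  · exact congrFun (eq_of_heq heq) ⟨v, hv⟩
  · exact (hx.eq_zero_of_notMem v hv).trans (hy.eq_zero_of_notMem v hv).symm

/-- The set `ℱ^ρ_τ` of well-labeled forests with `τ` trees and `ρ+τ+1` elements
has the same cardinality as the set `𝒟⁻¹_{3,3ρ+τ,ρ}` of binary words of length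
`4ρ+τ` with `3ρ+τ` letters 0 and `ρ` letters 1 whose reversal is 3-dominating. -/
theorem wellLabeledForests_card_eq_dInv_card (ρ τ : ℕ) (hτ : 1 ≤ τ) :
    Nat.card ↥(WellLabeledForests ρ τ) = Nat.card ↥(DInv 3 (3 * ρ + τ) ρ) := by
  have h := encard_completions ρ τ isPartial_floors sum_floors
  rw [completions_floors, card_floors, show τ + 1 + ρ = ρ + τ + 1 by omega,
    ← (injOn_restrict_isLabeledForest τ _).encard_image, ← wellLabeledForests_eq_image] at h
  exact congrArg ENat.toNat h
end

section
/- For every ρ ∈ ℕ and every τ ∈ ℕ with τ ≥ 1, the number of well-labeled forests with τ trees and ρ+τ+1 elements satisfies (4ρ+τ) · |ℱ^ρ_τ| = τ · C(4ρ+τ, ρ), where C denotes the binomial coefficient; equivalently |ℱ^ρ_τ| = (τ/(4ρ+τ)) · C(4ρ+τ, ρ). -/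
/-- Ordered forests with integer labels: `node a c r` is the forest whose first root is labeled
by `a` and has the forest `c` of descendants, the remaining trees being those of `r`. -/
inductive Hedge : Type
  | nil : Hedge
  | node (a : ℤ) (c r : Hedge) : Hedge

namespace Hedge

lemma add_one_ne_one (k : ℕ+) : k + 1 ≠ 1 := by
  intro h
  have := congrArg PNat.val h
  have := k.pos
  simp at *

/-- The number of nodes of a hedge. -/
def size : Hedge → ℕ
  | nil => 0
  | node _ c r => c.size + r.size + 1

/-- The label of the node at a given position, if there is such a node. -/
def lookup : Hedge → List ℕ+ → Option ℤ
  | nil, _ => none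
  | node _ _ _, [] => none
  | node a c r, i :: u =>
      if i = 1 then (if u = [] then some a else c.lookup u) else r.lookup ((i - 1) :: u)

@[simp] lemma lookup_nil (u : List ℕ+) : nil.lookup u = none := by simp [lookup]

@[simp] lemma lookup_empty (h : Hedge) : h.lookup [] = none := by cases h <;> simp [lookup]

@[simp] lemma lookup_node_one (a : ℤ) (c r : Hedge) : (node a c r).lookup [1] = some a := by
  simp [lookup]

lemma lookup_node_one_cons (a : ℤ) (c r : Hedge) {u : List ℕ+} (hu : u ≠ []) :
    (node a c r).lookup (1 :: u) = c.lookup u := by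
  simp [lookup, hu]

@[simp] lemma lookup_node_one_cons_cons (a : ℤ) (c r : Hedge) (k : ℕ+) (u : List ℕ+) :
    (node a c r).lookup (1 :: k :: u) = c.lookup (k :: u) := by
  simp [lookup]

@[simp] lemma lookup_node_one_append (a : ℤ) (c r : Hedge) (u : List ℕ+) (i : ℕ+) :
    (node a c r).lookup (1 :: (u ++ [i])) = c.lookup (u ++ [i]) :=
  lookup_node_one_cons a c r (by simp)

@[simp] lemma lookup_node_succ (a : ℤ) (c r : Hedge) (i : ℕ+) (u : List ℕ+) :
    (node a c r).lookup ((i + 1) :: u) = r.lookup (i :: u) := by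
  have h1 : i + 1 ≠ 1 := add_one_ne_one i
  have h2 : i + 1 - 1 = i := by simp
  rw [lookup, if_neg h1, h2]

lemma pnat_cases (i : ℕ+) : i = 1 ∨ ∃ k : ℕ+, i = k + 1 := by
  induction i using PNat.recOn with
  | one => exact Or.inl rfl
  | succ k _ => exact Or.inr ⟨k, rfl⟩

lemma lookup_injective : Function.Injective lookup := by
  intro h
  induction h with
  | nil =>
    rintro (_ | ⟨a, c, r⟩) e
    · rfl
    · simpa using congrFun e [1]
  | node a c r ihc ihr =>
    rintro (_ | ⟨a', c', r'⟩) e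
    · simpa using congrFun e [1]
    · have ha : a = a' := by simpa using congrFun e [1]
      have hc : c = c' := ihc <| by
        funext u
        rcases u with _ | ⟨i, u⟩
        · simp
        · simpa using congrFun e (1 :: i :: u)
      have hr : r = r' := ihr <| by
        funext u
        rcases u with _ | ⟨i, u⟩
        · simp
        · simpa using congrFun e ((i + 1) :: u)
      rw [ha, hc, hr]

/-- Shift the first entry of a position by one. -/
def bump : List ℕ+ → List ℕ+
  | [] => []
  | i :: u => (i + 1) :: u

lemma bump_injective : Function.Injective bump := by
  rintro (_ | ⟨i, u⟩) (_ | ⟨j, v⟩) h <;> simp_all [bump]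

open Classical in
/-- The set of positions of the nodes of a hedge. -/
noncomputable def positions : Hedge → Finset (List ℕ+)
  | nil => ∅
  | node _ c r => insert [1] ((c.positions.image (List.cons 1)) ∪ (r.positions.image bump))

lemma mem_positions (h : Hedge) : ∀ u, u ∈ h.positions ↔ h.lookup u ≠ none := by
  induction h with
  | nil => simp [positions]
  | node a c r ihc ihr =>
    intro u
    rcases u with _ | ⟨i, u⟩
    · simp only [positions, Finset.mem_insert, Finset.mem_union, Finset.mem_image, ihr,
        lookup_empty, ne_eq, not_true, iff_false]
      rintro (h | ⟨v, -, h⟩ | ⟨v, hv, h⟩)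
      · simp at h
      · simp at h
      · rcases v with _ | ⟨k, v⟩
        · simp at hv
        · simp [bump] at h
    · rcases pnat_cases i with rfl | ⟨k, rfl⟩
      · have hb : ∀ v, bump v ≠ 1 :: u := by
          rintro (_ | ⟨k, v⟩) <;> simp [bump, add_one_ne_one]
        rcases u with _ | ⟨j, u⟩
        · simp [positions]
        · simp [positions, ihc, hb]
      · simp only [positions, Finset.mem_insert, Finset.mem_union, Finset.mem_image, ihr,
          lookup_node_succ]
        constructor
        · rintro (h | ⟨v, -, h⟩ | ⟨v, hv, h⟩)
          · simp [add_one_ne_one] at h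
          · exact absurd (List.cons.inj h).1.symm (add_one_ne_one k)
          · rcases v with _ | ⟨k', v⟩
            · simp at hv
            · simp [bump] at h
              rw [← h.1, ← h.2]
              exact hv
        · intro h
          exact Or.inr (Or.inr ⟨k :: u, h, rfl⟩)

lemma card_positions (h : Hedge) : h.positions.card = h.size := by
  induction h with
  | nil => rfl
  | node a c r ihc ihr =>
    have hb : ∀ v u, bump v ≠ 1 :: u := by
      rintro (_ | ⟨k, v⟩) <;> simp [bump, add_one_ne_one]
    rw [positions, Finset.card_insert_of_notMem, Finset.card_union_of_disjoint,
      Finset.card_image_of_injective _ (List.cons_injective),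
      Finset.card_image_of_injective _ bump_injective, ihc, ihr, size]
    · rw [Finset.disjoint_left]
      intro u hu hv
      simp only [Finset.mem_image] at hu hv
      obtain ⟨u, -, rfl⟩ := hu
      obtain ⟨v, -, hv⟩ := hv
      exact hb _ _ hv
    · simp [hb, mem_positions]

lemma lookup_parent (h : Hedge) :
    ∀ (u : List ℕ+) (i : ℕ+), u ≠ [] → h.lookup (u ++ [i]) ≠ none → h.lookup u ≠ none := by
  induction h with
  | nil => simp
  | node a c r ihc ihr =>
    intro u i hu h
    rcases u with _ | ⟨k, u⟩
    · exact absurd rfl hu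
    · rcases pnat_cases k with rfl | ⟨k, rfl⟩
      · rcases u with _ | ⟨j, u⟩
        · simp
        · rw [lookup_node_one_cons_cons]
          exact ihc _ i (by simp) (by simpa using h)
      · rw [lookup_node_succ]
        exact ihr _ i (by simp) (by simpa using h)

lemma lookup_children (h : Hedge) :
    ∀ u : List ℕ+, ∃ n : ℕ, ∀ i : ℕ+, h.lookup (u ++ [i]) ≠ none ↔ (i : ℕ) ≤ n := by
  induction h with
  | nil => exact fun u => ⟨0, fun i => by simp⟩
  | node a c r ihc ihr =>
    intro u
    rcases u with _ | ⟨k, u⟩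
    · obtain ⟨n, hn⟩ := ihr []
      refine ⟨n + 1, fun i => ?_⟩
      rcases pnat_cases i with rfl | ⟨i, rfl⟩
      · simp
      · simpa using hn i
    · rcases pnat_cases k with rfl | ⟨k, rfl⟩
      · obtain ⟨n, hn⟩ := ihc u
        exact ⟨n, fun i => by simpa using hn i⟩
      · obtain ⟨n, hn⟩ := ihr (k :: u)
        exact ⟨n, fun i => by simpa using hn i⟩

/-- The partial labelings of positions whose domain is closed under taking parents and
previous siblings. -/
structure IsPrefixClosed (f : List ℕ+ → Option ℤ) : Prop where
  empty : f [] = none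
  parent : ∀ u i, u ≠ [] → f (u ++ [i]) ≠ none → f u ≠ none
  sibling : ∀ u i, f (u ++ [i + 1]) ≠ none → f (u ++ [i]) ≠ none

lemma IsPrefixClosed.root {f : List ℕ+ → Option ℤ} (hf : IsPrefixClosed f) (i : ℕ+)
    (u : List ℕ+) (h : f (i :: u) ≠ none) : f [1] ≠ none := by
  have h1 : f [i] ≠ none := by
    induction u using List.reverseRecOn with
    | nil => exact h
    | append_singleton u j ih => exact ih (hf.parent (i :: u) j (by simp) h)
  clear h
  induction i using PNat.recOn with
  | one => exact h1
  | succ i ih => exact ih (hf.sibling [] i h1)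

lemma exists_lookup_eq (N : ℕ) : ∀ f : List ℕ+ → Option ℤ, IsPrefixClosed f →
    (∀ u, f u ≠ none → (u.map PNat.val).sum ≤ N) → ∃ h : Hedge, h.lookup = f := by
  induction N with
  | zero =>
    intro f hf hN
    refine ⟨nil, funext fun u => ?_⟩
    rw [lookup_nil]
    by_contra h
    rcases u with _ | ⟨i, u⟩
    · exact h hf.empty.symm
    · have := hN _ (Ne.symm h)
      have := i.pos
      simp at *
  | succ N ih =>
    intro f hf hN
    cases h1 : f [1] with
    | none =>
      refine ⟨nil, funext fun u => ?_⟩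
      rw [lookup_nil]
      by_contra h
      rcases u with _ | ⟨i, u⟩
      · exact h hf.empty.symm
      · exact hf.root i u (Ne.symm h) h1
    | some a =>
      obtain ⟨c, hc⟩ := ih (fun u => if u = [] then none else f (1 :: u))
        ⟨by simp, fun u i hu => by simpa [hu] using hf.parent (1 :: u) i (by simp),
          fun u i => by simpa using hf.sibling (1 :: u) i⟩
        (fun u hu => by
          by_cases h : u = []
          · simp [h]
          · simp only [h, if_false] at hu
            have := hN _ hu
            simp at this ⊢
            omega)
      obtain ⟨r, hr⟩ := ih (fun u => if u = [] then none else f (bump u))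
        ⟨by simp, fun u i hu => by
            rcases u with _ | ⟨k, u⟩
            · exact absurd rfl hu
            · simpa [bump] using hf.parent ((k + 1) :: u) i (by simp),
          fun u i => by
            rcases u with _ | ⟨k, u⟩
            · simpa [bump] using hf.sibling [] (i + 1)
            · simpa [bump] using hf.sibling ((k + 1) :: u) i⟩
        (fun u hu => by
          rcases u with _ | ⟨k, u⟩
          · simp
          · have := hN _ (by simpa [bump] using hu : f ((k + 1) :: u) ≠ none)
            simp at this ⊢
            omega)
      refine ⟨node a c r, funext fun u => ?_⟩
      rcases u with _ | ⟨i, u⟩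
      · simp [hf.empty]
      · rcases pnat_cases i with rfl | ⟨i, rfl⟩
        · rcases u with _ | ⟨k, u⟩
          · simp [h1]
          · simp [hc]
        · simp [hr, bump]

/-- The hedges with nondecreasing root labels in `[lo, hi)` which are well-labeled below
their roots. -/
def Good : ℤ → ℤ → Hedge → Prop
  | _, _, nil => True
  | lo, hi, node a c r => lo ≤ a ∧ a < hi ∧ Good (a - 1) (a + 2) c ∧ Good a hi r

/-- `Hedge.Good` in terms of the labels at given positions. -/
structure LabelOK (lo hi : ℤ) (f : List ℕ+ → Option ℤ) : Prop where
  root : ∀ i a, f [i] = some a → lo ≤ a ∧ a < hi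
  child : ∀ u i a b, u ≠ [] → f u = some a → f (u ++ [i]) = some b → a - 1 ≤ b ∧ b < a + 2
  mono : ∀ u i j a b, i ≤ j → f (u ++ [i]) = some a → f (u ++ [j]) = some b → a ≤ b

lemma labelOK_node {lo hi a : ℤ} {c r : Hedge} :
    LabelOK lo hi (node a c r).lookup ↔
      lo ≤ a ∧ a < hi ∧ LabelOK (a - 1) (a + 2) c.lookup ∧ LabelOK a hi r.lookup := by
  constructor
  · intro H
    have h1 := H.root 1 a (by simp)
    refine ⟨h1.1, h1.2, ⟨?_, ?_, ?_⟩, ⟨?_, ?_, ?_⟩⟩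
    · intro i b hb
      exact H.child [1] i a b (by simp) (by simp) (by simpa using hb)
    · intro u i b b' hu hb hb'
      exact H.child (1 :: u) i b b' (by simp) (by rwa [lookup_node_one_cons _ _ _ hu])
        (by simpa using hb')
    · intro u i j b b' hij hb hb'
      exact H.mono (1 :: u) i j b b' hij (by simpa using hb) (by simpa using hb')
    · intro i b hb
      have hb' : (node a c r).lookup [i + 1] = some b := by simpa using hb
      exact ⟨H.mono [] 1 (i + 1) a b (one_le) (by simp) hb', (H.root _ _ hb').2⟩
    · intro u i b b' hu hb hb'
      rcases u with _ | ⟨k, u⟩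
      · exact absurd rfl hu
      · exact H.child ((k + 1) :: u) i b b' (by simp) (by simpa using hb) (by simpa using hb')
    · intro u i j b b' hij hb hb'
      rcases u with _ | ⟨k, u⟩
      · exact H.mono [] (i + 1) (j + 1) b b' (by simpa using hij) (by simpa using hb)
          (by simpa using hb')
      · exact H.mono ((k + 1) :: u) i j b b' hij (by simpa using hb) (by simpa using hb')
  · rintro ⟨hlo, hhi, hc, hr⟩
    refine ⟨?_, ?_, ?_⟩
    · intro i b hb
      rcases pnat_cases i with rfl | ⟨i, rfl⟩
      · simp at hb
        omega
      · have := hr.root i b (by simpa using hb)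
        omega
    · intro u i b b' hu hb hb'
      rcases u with _ | ⟨k, u⟩
      · exact absurd rfl hu
      · rcases pnat_cases k with rfl | ⟨k, rfl⟩
        · rcases u with _ | ⟨j, u⟩
          · simp at hb hb'
            exact hb ▸ hc.root i b' hb'
          · exact hc.child (j :: u) i b b' (by simp) (by simpa using hb) (by simpa using hb')
        · exact hr.child (k :: u) i b b' (by simp) (by simpa using hb) (by simpa using hb')
    · intro u i j b b' hij hb hb'
      rcases u with _ | ⟨k, u⟩
      · rcases pnat_cases i with rfl | ⟨i, rfl⟩
        · rcases pnat_cases j with rfl | ⟨j, rfl⟩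
          · simp at hb hb'
            omega
          · simp at hb hb'
            exact hb ▸ (hr.root j b' hb').1
        · rcases pnat_cases j with rfl | ⟨j, rfl⟩
          · exact absurd (le_antisymm hij (one_le)) (add_one_ne_one i)
          · exact hr.mono [] i j b b' (by simpa using hij) (by simpa using hb)
              (by simpa using hb')
      · rcases pnat_cases k with rfl | ⟨k, rfl⟩
        · exact hc.mono u i j b b' hij (by simpa using hb) (by simpa using hb')
        · exact hr.mono (k :: u) i j b b' hij (by simpa using hb) (by simpa using hb')

lemma labelOK_iff_good (h : Hedge) : ∀ lo hi, LabelOK lo hi h.lookup ↔ Good lo hi h := by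
  induction h with
  | nil => exact fun lo hi => ⟨fun _ => trivial, fun _ => ⟨by simp, by simp, by simp⟩⟩
  | node a c r ihc ihr =>
    intro lo hi
    rw [labelOK_node, ihc, ihr, Good]

/-- The hedges coming from well-labeled forests with `t` trees. -/
def TopGood : ℕ → Hedge → Prop
  | _, nil => False
  | 0, node a c r => a = 0 ∧ c = nil ∧ r = nil
  | t + 1, node a c r => a = 0 ∧ Good (-1) 0 c ∧ TopGood t r

/-- `Hedge.TopGood` in terms of the labels at given positions. -/
structure TopOK (t : ℕ) (f : List ℕ+ → Option ℤ) : Prop where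
  floors : ∀ i : ℕ+, f [i] ≠ none ↔ (i : ℕ) ≤ t + 1
  last : ∀ i, f [Nat.succPNat t, i] = none
  floor_label : ∀ i a, f [i] = some a → a = 0
  second_label : ∀ i j a, f [i, j] = some a → a = -1
  child : ∀ u i a b, 2 ≤ u.length → f u = some a → f (u ++ [i]) = some b →
    a - 1 ≤ b ∧ b ≤ a + 1
  mono : ∀ u i j a b, 2 ≤ u.length → i ≤ j → f (u ++ [i]) = some a → f (u ++ [j]) = some b →
    a ≤ b

lemma eq_nil_of_lookup_one {h : Hedge} (h1 : h.lookup [1] = none) : h = nil := by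
  cases h with
  | nil => rfl
  | node a c r => simp at h1

lemma topOK_zero_iff {h : Hedge} : TopOK 0 h.lookup ↔ TopGood 0 h := by
  cases h with
  | nil =>
    refine ⟨fun H => ?_, False.elim⟩
    simpa using H.floors 1
  | node a c r =>
    constructor
    · intro H
      refine ⟨H.floor_label 1 a (by simp), eq_nil_of_lookup_one ?_, eq_nil_of_lookup_one ?_⟩
      · exact (lookup_node_one_cons_cons a c r 1 []).symm.trans (H.last 1)
      · have := H.floors (1 + 1)
        simpa using this
    · rintro ⟨rfl, rfl, rfl⟩
      have key : ∀ u b, (node 0 nil nil).lookup u = some b → u = [1] ∧ b = 0 := by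
        intro u b hb
        rcases u with _ | ⟨k, u⟩
        · simp at hb
        · rcases pnat_cases k with rfl | ⟨k, rfl⟩
          · rcases u with _ | ⟨j, u⟩
            · simpa [eq_comm] using hb
            · simp at hb
          · simp at hb
      refine ⟨?_, ?_, ?_, ?_, ?_, ?_⟩
      · intro i
        rcases pnat_cases i with rfl | ⟨i, rfl⟩ <;> simp
      · intro i
        by_contra h
        obtain ⟨b, hb⟩ := Option.ne_none_iff_exists'.1 h
        simpa using (key _ _ hb).1
      · intro i b hb
        exact (key _ _ hb).2
      · intro i j b hb
        simpa using (key _ _ hb).1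
      · intro u i b b' hu hb
        simp [(key _ _ hb).1] at hu
      · intro u i j b b' hu _ hb
        have := congrArg List.length (key _ _ hb).1
        simp at this
        simp [this] at hu

lemma topOK_succ_iff {t : ℕ} {a : ℤ} {c r : Hedge} :
    TopOK (t + 1) (node a c r).lookup ↔
      a = 0 ∧ LabelOK (-1) 0 c.lookup ∧ TopOK t r.lookup := by
  have hs : Nat.succPNat (t + 1) = Nat.succPNat t + 1 := rfl
  constructor
  · intro H
    have hroot : ∀ i b, c.lookup [i] = some b → b = -1 := fun i b hb =>
      H.second_label 1 i b (by simpa using hb)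
    refine ⟨H.floor_label 1 a (by simp), ⟨?_, ?_, ?_⟩, ⟨?_, ?_, ?_, ?_, ?_, ?_⟩⟩
    · intro i b hb
      have := hroot i b hb
      omega
    · intro u i b b' hu hb hb'
      have := H.child (1 :: u) i b b' (by simpa [Nat.one_le_iff_ne_zero] using hu)
        (by rwa [lookup_node_one_cons _ _ _ hu]) (by simpa using hb')
      omega
    · intro u i j b b' hij hb hb'
      rcases u with _ | ⟨k, u⟩
      · rw [hroot i b hb, hroot j b' hb']
      · exact H.mono (1 :: k :: u) i j b b' (by simp) hij (by simpa using hb)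
          (by simpa using hb')
    · intro i
      simpa using H.floors (i + 1)
    · intro i
      simpa [hs] using H.last i
    · intro i b hb
      exact H.floor_label (i + 1) b (by simpa using hb)
    · intro i j b hb
      exact H.second_label (i + 1) j b (by simpa using hb)
    · intro u i b b' hu hb hb'
      rcases u with _ | ⟨k, u⟩
      · simp at hu
      · exact H.child ((k + 1) :: u) i b b' (by simpa using hu) (by simpa using hb)
          (by simpa using hb')
    · intro u i j b b' hu hij hb hb'
      rcases u with _ | ⟨k, u⟩
      · simp at hu
      · exact H.mono ((k + 1) :: u) i j b b' (by simpa using hu) hij (by simpa using hb)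
          (by simpa using hb')
  · rintro ⟨rfl, hc, hr⟩
    refine ⟨?_, ?_, ?_, ?_, ?_, ?_⟩
    · intro i
      rcases pnat_cases i with rfl | ⟨i, rfl⟩
      · simp
      · simpa using hr.floors i
    · intro i
      simpa [hs] using hr.last i
    · intro i b hb
      rcases pnat_cases i with rfl | ⟨i, rfl⟩
      · simpa [eq_comm] using hb
      · exact hr.floor_label i b (by simpa using hb)
    · intro i j b hb
      rcases pnat_cases i with rfl | ⟨i, rfl⟩
      · have := hc.root j b (by simpa using hb)
        omega
      · exact hr.second_label i j b (by simpa using hb)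
    · intro u i b b' hu hb hb'
      rcases u with _ | ⟨k, u⟩
      · simp at hu
      · rcases pnat_cases k with rfl | ⟨k, rfl⟩
        · have hu' : u ≠ [] := by rintro rfl; simp at hu
          have := hc.child u i b b' hu' (by rwa [lookup_node_one_cons _ _ _ hu'] at hb)
            (by simpa using hb')
          omega
        · exact hr.child (k :: u) i b b' (by simpa using hu) (by simpa using hb)
            (by simpa using hb')
    · intro u i j b b' hu hij hb hb'
      rcases u with _ | ⟨k, u⟩
      · simp at hu
      · rcases pnat_cases k with rfl | ⟨k, rfl⟩
        · exact hc.mono u i j b b' hij (by simpa using hb) (by simpa using hb')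
        · exact hr.mono (k :: u) i j b b' (by simpa using hu) hij (by simpa using hb)
            (by simpa using hb')

lemma topOK_iff_topGood (t : ℕ) : ∀ h : Hedge, TopOK t h.lookup ↔ TopGood t h := by
  induction t with
  | zero => exact fun _ => topOK_zero_iff
  | succ t ih =>
    rintro (_ | ⟨a, c, r⟩)
    · refine ⟨fun H => ?_, False.elim⟩
      simpa using H.floors 1
    · rw [topOK_succ_iff, ih, labelOK_iff_good, TopGood]

/-- The number of good hedges with `n` nodes whose root labels are taken from `j` consecutive
integers. -/
def count : ℕ → ℕ → ℕ
  | 0, _ => 1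
  | _ + 1, 0 => 0
  | n + 1, j + 1 => count (n + 1) j + ∑ i : Fin (n + 1), count i 3 * count (n - i) (j + 1)
termination_by n j => (n, j)

lemma count_zero (j : ℕ) : count 0 j = 1 := by rw [count]

lemma count_succ_zero (n : ℕ) : count (n + 1) 0 = 0 := by rw [count]

lemma count_succ_succ (n j : ℕ) : count (n + 1) (j + 1) =
    count (n + 1) j + ∑ p ∈ Finset.HasAntidiagonal.antidiagonal n, count p.1 3 * count p.2 (j + 1) := by
  rw [count, Finset.Nat.sum_antidiagonal_eq_sum_range_succ (fun x y => count x 3 * count y (j + 1)),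
    Fin.sum_univ_eq_sum_range (fun i => count i 3 * count (n - i) (j + 1))]

lemma size_eq_zero {h : Hedge} : h.size = 0 ↔ h = nil := by
  cases h <;> simp [size]

open Classical in
/-- Nodes with first label `a` over given sets of hedges, with sizes adding up to `n`. -/
noncomputable def nodes (a : ℤ) (s t : ℕ → Finset Hedge) (n : ℕ) : Finset Hedge :=
  ((Finset.HasAntidiagonal.antidiagonal n).sigma fun p => s p.1 ×ˢ t p.2).image fun x => node a x.2.1 x.2.2

lemma mem_nodes {a : ℤ} {s t : ℕ → Finset Hedge} {n : ℕ} {h : Hedge} :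
    h ∈ nodes a s t n ↔ ∃ i j, i + j = n ∧ ∃ c ∈ s i, ∃ r ∈ t j, h = node a c r := by
  simp only [nodes, Finset.mem_image, Finset.mem_sigma, Finset.HasAntidiagonal.mem_antidiagonal,
    Finset.mem_product]
  constructor
  · rintro ⟨⟨⟨i, j⟩, ⟨c, r⟩⟩, ⟨hij, hc, hr⟩, rfl⟩
    exact ⟨i, j, hij, c, hc, r, hr, rfl⟩
  · rintro ⟨i, j, hij, c, hc, r, hr, rfl⟩
    exact ⟨⟨⟨i, j⟩, ⟨c, r⟩⟩, ⟨hij, hc, hr⟩, rfl⟩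

lemma card_nodes {a : ℤ} {s t : ℕ → Finset Hedge} {n k : ℕ}
    (hs : ∀ i ≤ n, ∀ h ∈ s i, h.size = i) (ht : ∀ i ≤ n, ∀ h ∈ t i, h.size = i + k) :
    (nodes a s t n).card = ∑ p ∈ Finset.HasAntidiagonal.antidiagonal n, (s p.1).card * (t p.2).card := by
  classical
  rw [nodes, Finset.card_image_of_injOn, Finset.card_sigma]
  · simp
  · rintro ⟨⟨i, j⟩, ⟨c, r⟩⟩ h ⟨⟨i', j'⟩, ⟨c', r'⟩⟩ h' e
    simp only [Finset.coe_sigma, Set.mem_sigma_iff, Finset.mem_coe, Finset.HasAntidiagonal.mem_antidiagonal,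
      Finset.mem_product] at h h'
    simp only [node.injEq, true_and] at e
    obtain ⟨rfl, rfl⟩ := e
    obtain rfl : i = i' := by
      rw [← hs i (by omega) c h.2.1, ← hs i' (by omega) c h'.2.1]
    obtain rfl : j = j' := by
      have h1 := ht j (by omega) r h.2.2
      have h2 := ht j' (by omega) r h'.2.2
      omega
    rfl

lemma good_succ_iff {lo : ℤ} {j n : ℕ} {h : Hedge} :
    (Good lo (lo + (j + 1 : ℕ)) h ∧ h.size = n + 1) ↔
      (Good (lo + 1) (lo + 1 + j) h ∧ h.size = n + 1) ∨
        ∃ c r, h = node lo c r ∧ Good (lo - 1) (lo - 1 + (3 : ℕ)) c ∧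
          Good lo (lo + (j + 1 : ℕ)) r ∧ c.size + r.size = n := by
  have e : lo + ((j + 1 : ℕ) : ℤ) = lo + 1 + j := by push_cast; ring
  have e3 : ∀ a : ℤ, a - 1 + ((3 : ℕ) : ℤ) = a + 2 := fun a => by push_cast; ring
  rw [e, e3]
  cases h with
  | nil => simp [size]
  | node a c r =>
    simp only [Good, size, node.injEq, Nat.add_right_cancel_iff]
    constructor
    · rintro ⟨⟨h1, h2, h3, h4⟩, h5⟩
      rcases h1.eq_or_lt with rfl | h1
      · exact Or.inr ⟨c, r, ⟨rfl, rfl, rfl⟩, h3, h4, h5⟩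
      · exact Or.inl ⟨⟨h1, h2, h3, h4⟩, h5⟩
    · rintro (⟨⟨h1, h2, h3, h4⟩, h5⟩ | ⟨c, r, ⟨rfl, rfl, rfl⟩, h3, h4, h5⟩)
      · exact ⟨⟨by omega, h2, h3, h4⟩, h5⟩
      · exact ⟨⟨le_rfl, by omega, h3, h4⟩, h5⟩

lemma exists_finset_good (n : ℕ) : ∀ (j : ℕ) (lo : ℤ), ∃ s : Finset Hedge,
    s.card = count n j ∧ ∀ h, h ∈ s ↔ Good lo (lo + j) h ∧ h.size = n := by
  classical
  induction n using Nat.strong_induction_on with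
  | _ n ihn =>
  rcases n with _ | n
  · intro j lo
    refine ⟨{nil}, by simp [count_zero], fun h => ?_⟩
    rw [Finset.mem_singleton, size_eq_zero]
    exact ⟨fun e => ⟨e ▸ trivial, e⟩, fun e => e.2⟩
  · intro j
    induction j with
    | zero =>
      intro lo
      refine ⟨∅, by simp [count_succ_zero], fun h => ?_⟩
      cases h with
      | nil => simp [size]
      | node a c r =>
        simp only [Finset.notMem_empty, Good, false_iff]
        rintro ⟨⟨h1, h2, -⟩, -⟩
        simp at h2
        omega
    | succ j ihj =>
      intro lo
      obtain ⟨s, hsc, hs⟩ := ihj (lo + 1)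
      choose! C hCc hC using fun i (hi : i < n + 1) => ihn i hi 3 (lo - 1)
      choose! R hRc hR using fun i (hi : i < n + 1) => ihn i hi (j + 1) lo
      refine ⟨s ∪ nodes lo C R n, ?_, fun h => ?_⟩
      · rw [Finset.card_union_of_disjoint, hsc, card_nodes (k := 0), count_succ_succ]
        · congr 1
          refine Finset.sum_congr rfl fun p hp => ?_
          rw [Finset.HasAntidiagonal.mem_antidiagonal] at hp
          rw [hCc _ (by omega), hRc _ (by omega)]
        · exact fun i hi h hh => ((hC i (by omega) h).1 hh).2
        · exact fun i hi h hh => ((hR i (by omega) h).1 hh).2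
        · rw [Finset.disjoint_left]
          intro h h1 h2
          obtain ⟨_, _, _, c, _, r, _, rfl⟩ := mem_nodes.1 h2
          have := ((hs _).1 h1).1.1
          omega
      · rw [Finset.mem_union, hs, good_succ_iff, mem_nodes]
        refine or_congr Iff.rfl ⟨?_, ?_⟩
        · rintro ⟨i, k, hik, c, hc, r, hr, rfl⟩
          have h1 := (hC i (by omega) c).1 hc
          have h2 := (hR k (by omega) r).1 hr
          exact ⟨c, r, rfl, h1.1, h2.1, by omega⟩
        · rintro ⟨c, r, rfl, h1, h2, h3⟩
          exact ⟨c.size, r.size, h3, c, (hC _ (by omega) c).2 ⟨h1, rfl⟩, r,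
            (hR _ (by omega) r).2 ⟨h2, rfl⟩, rfl⟩

lemma TopGood.lt_size {t : ℕ} {h : Hedge} (H : TopGood t h) : t < h.size := by
  induction t generalizing h with
  | zero => cases h with
    | nil => exact H.elim
    | node a c r => simp [size]
  | succ t ih => cases h with
    | nil => exact H.elim
    | node a c r =>
      have := ih H.2.2
      simp only [size]
      omega

open PowerSeries in
lemma exists_finset_topGood (t : ℕ) : ∀ n : ℕ, ∃ s : Finset Hedge,
    s.card = coeff n ((PowerSeries.mk fun n => count n 1) ^ t) ∧
      ∀ h, h ∈ s ↔ TopGood t h ∧ h.size = n + t + 1 := by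
  induction t with
  | zero =>
    rintro (_ | n)
    · refine ⟨{node 0 nil nil}, by simp, fun h => ?_⟩
      cases h with
      | nil => simp [TopGood]
      | node a c r =>
        simp only [Finset.mem_singleton, node.injEq, TopGood]
        exact ⟨fun h => ⟨h, by simp [size, h.2.1, h.2.2]⟩, fun h => h.1⟩
    · refine ⟨∅, by simp [coeff_one], fun h => ?_⟩
      cases h with
      | nil => simp [TopGood]
      | node a c r =>
        simp only [Finset.notMem_empty, TopGood, false_iff]
        rintro ⟨⟨rfl, rfl, rfl⟩, h⟩
        simp [size] at h
  | succ t ih =>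
    intro n
    choose R hRc hR using ih
    choose C hCc hC using fun i => exists_finset_good i 1 (-1)
    refine ⟨nodes 0 C R n, ?_, fun h => ?_⟩
    · rw [card_nodes (k := t + 1), pow_succ', coeff_mul]
      · refine Finset.sum_congr rfl fun p _ => ?_
        rw [hCc, hRc, coeff_mk]
      · exact fun i _ h hh => ((hC i h).1 hh).2
      · exact fun i _ h hh => ((hR i h).1 hh).2
    · rw [mem_nodes]
      constructor
      · rintro ⟨i, k, hik, c, hc, r, hr, rfl⟩
        have h1 := (hC i c).1 hc
        have h2 := (hR k r).1 hr
        exact ⟨⟨rfl, h1.1, h2.1⟩, by simp only [size]; omega⟩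
      · rintro ⟨h1, h2⟩
        cases h with
        | nil => exact h1.elim
        | node a c r =>
          obtain ⟨rfl, hc, hr⟩ := h1
          simp only [size] at h2
          have hle := hr.lt_size
          exact ⟨c.size, n - c.size, by omega, c, (hC _ c).2 ⟨hc, rfl⟩, r,
            (hR _ r).2 ⟨hr, by omega⟩, rfl⟩

section Counting

open PowerSeries

/-- Generating function of `Hedge.count · j`. -/
noncomputable def genFun (j : ℕ) : PowerSeries ℤ := PowerSeries.mk fun n => (count n j : ℤ)

lemma genFun_zero : genFun 0 = 1 := by
  ext n
  cases n with
  | zero => simp [genFun, count_zero]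
  | succ n => simp [genFun, count_succ_zero, coeff_one]

lemma genFun_succ (j : ℕ) :
    genFun (j + 1) = genFun j + X * (genFun 3 * genFun (j + 1)) := by
  ext n
  cases n with
  | zero => simp [genFun, count_zero]
  | succ n =>
    rw [map_add, coeff_succ_X_mul, coeff_mul]
    simp [genFun, count_succ_succ]

lemma genFun_eq_pow (j : ℕ) : genFun j = genFun 1 ^ j := by
  induction j with
  | zero => rw [genFun_zero, pow_zero]
  | succ j ih =>
    have h0 := genFun_succ 0
    have h1 := genFun_succ j
    rw [genFun_zero, zero_add] at h0
    rw [pow_succ, ← ih]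
    linear_combination genFun 1 * h1 - genFun (j + 1) * h0

lemma genFun_one_pow_succ (t : ℕ) :
    genFun 1 ^ (t + 1) = genFun 1 ^ t + X * genFun 1 ^ (t + 4) := by
  have h := genFun_succ t
  rw [genFun_eq_pow (t + 1), genFun_eq_pow t, genFun_eq_pow 3] at h
  rw [h]
  ring_nf

lemma coeff_genFun_one_pow (n : ℕ) : ∀ t : ℕ,
    (4 * n + t : ℤ) * coeff n (genFun 1 ^ t) = t * (4 * n + t).choose n := by
  induction n with
  | zero =>
    intro t
    have : constantCoeff (genFun 1) = 1 := by
      simp [genFun, count_zero, ← coeff_zero_eq_constantCoeff_apply]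
    simp [this]
  | succ n ihn =>
    intro t
    induction t with
    | zero => simp [coeff_one]
    | succ t iht =>
      have h1 := ihn (t + 4)
      rw [genFun_one_pow_succ, map_add, coeff_succ_X_mul]
      generalize coeff (n + 1) (genFun 1 ^ t) = A at *
      generalize coeff n (genFun 1 ^ (t + 4)) = B at *
      have e1 : 4 * (n + 1) + (t + 1) = (4 * n + t + 4) + 1 := by ring
      have e2 : 4 * (n + 1) + t = 4 * n + t + 4 := by ring
      have e3 : 4 * n + (t + 4) = 4 * n + t + 4 := by ring
      rw [e3] at h1
      rw [e2] at iht
      rw [e1]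
      have c1 := Nat.add_one_mul_choose_eq (4 * n + t + 4) n
      have c2 := Nat.choose_succ_succ (4 * n + t + 4) n
      have c1' : ((4 * n + t + 4 + 1 : ℕ) : ℤ) * ((4 * n + t + 4).choose n : ℤ) =
        ((4 * n + t + 4 + 1).choose (n + 1) : ℤ) * ((n + 1 : ℕ) : ℤ) := by exact_mod_cast c1
      have c2' : ((4 * n + t + 4 + 1).choose (n + 1) : ℤ) =
        ((4 * n + t + 4).choose n : ℤ) + ((4 * n + t + 4).choose (n + 1) : ℤ) := by
        exact_mod_cast c2
      generalize ((4 * n + t + 4 + 1).choose (n + 1) : ℤ) = c at *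
      generalize ((4 * n + t + 4).choose n : ℤ) = d at *
      generalize ((4 * n + t + 4).choose (n + 1) : ℤ) = e at *
      push_cast at *
      have hM : (4 * n + t + 4 : ℤ) ≠ 0 := by positivity
      apply mul_left_cancel₀ hM
      linear_combination (4 * n + t + 5 : ℤ) * (h1 + iht)
        - (4 * n + t + 5 : ℤ) * t * c2' + 4 * c1'

end Counting

lemma card_topGood (n t : ℕ) :
    (4 * n + t) * Nat.card {h : Hedge | TopGood t h ∧ h.size = n + t + 1} =
      t * (4 * n + t).choose n := by
  obtain ⟨s, hc, hs⟩ := exists_finset_topGood t n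
  have e : {h : Hedge | TopGood t h ∧ h.size = n + t + 1} = (s : Set Hedge) := by
    ext h
    simp [hs]
  have hg : (s.card : ℤ) = PowerSeries.coeff n (genFun 1 ^ t) := by
    have : genFun 1 = PowerSeries.map (Nat.castRingHom ℤ)
        (PowerSeries.mk fun n => count n 1) := by
      ext n
      simp [genFun]
    rw [this, ← map_pow, PowerSeries.coeff_map, hc]
    rfl
  have := coeff_genFun_one_pow n t
  rw [← hg] at this
  rw [e]
  simp only [Finset.coe_sort_coe, Nat.card_eq_fintype_card, Fintype.card_coe]
  exact_mod_cast this

open Classical in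
/-- A labeled set of positions, seen as a partial function. -/
noncomputable def toPartial (x : Σ F : Finset (List ℕ+), {u : List ℕ+ // u ∈ F} → ℤ) :
    List ℕ+ → Option ℤ :=
  fun u => if h : u ∈ x.1 then some (x.2 ⟨u, h⟩) else none

section

variable {x : Σ F : Finset (List ℕ+), {u : List ℕ+ // u ∈ F} → ℤ}

lemma mem_iff_toPartial {u : List ℕ+} : u ∈ x.1 ↔ toPartial x u ≠ none := by
  unfold toPartial
  split <;> simp_all

lemma toPartial_of_mem {u : List ℕ+} (h : u ∈ x.1) : toPartial x u = some (x.2 ⟨u, h⟩) := by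
  simp [toPartial, h]

lemma exists_of_toPartial_eq_some {u : List ℕ+} {a : ℤ} (h : toPartial x u = some a) :
    ∃ hu : u ∈ x.1, x.2 ⟨u, hu⟩ = a := by
  have hu : u ∈ x.1 := mem_iff_toPartial.2 (by simp [h])
  exact ⟨hu, by simpa [toPartial_of_mem hu] using h⟩

end

lemma toPartial_injective : Function.Injective toPartial := by
  rintro ⟨F, l⟩ ⟨F', l'⟩ h
  obtain rfl : F = F' := by
    ext u
    have h1 := mem_iff_toPartial (x := ⟨F, l⟩) (u := u)
    have h2 := mem_iff_toPartial (x := ⟨F', l'⟩) (u := u)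
    rw [h] at h1
    exact h1.trans h2.symm
  congr 1
  funext ⟨u, hu⟩
  simpa [toPartial, hu] using congrFun h u

lemma exists_toPartial_eq (h : Hedge) : ∃ x, toPartial x = h.lookup := by
  refine ⟨⟨h.positions, fun u => (h.lookup u.1).getD 0⟩, funext fun u => ?_⟩
  by_cases hu : u ∈ h.positions
  · obtain ⟨a, ha⟩ := Option.ne_none_iff_exists'.1 ((mem_positions h u).1 hu)
    simp [toPartial, hu, ha]
  · have : h.lookup u = none := by simpa [mem_positions] using hu
    simp [toPartial, hu, this]

lemma exists_lookup_eq_toPartial {t : ℕ}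
    {x : Σ F : Finset (List ℕ+), {u : List ℕ+ // u ∈ F} → ℤ} (hx : IsForest x.1 t) :
    ∃ h : Hedge, h.lookup = toPartial x := by
  obtain ⟨h0, h1, h2, h3, -⟩ := hx
  have hp : ∀ u i, u ≠ [] → u ++ [i] ∈ x.1 → u ∈ x.1 := by
    intro u i hu h
    have := h2 _ h (by simpa [Nat.one_le_iff_ne_zero] using hu)
    simpa using this
  refine exists_lookup_eq (x.1.sup fun u => (u.map PNat.val).sum) _ ⟨?_, ?_, ?_⟩ ?_
  · by_contra h
    exact h0 (mem_iff_toPartial.2 h)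
  · intro u i hu h
    rw [← mem_iff_toPartial] at *
    exact hp u i hu h
  · intro u i h
    rw [← mem_iff_toPartial] at *
    by_cases hu : u = []
    · subst hu
      have := (h1 (i + 1)).1 h
      refine (h1 i).2 ?_
      simp at this
      omega
    · obtain ⟨n, hn⟩ := h3 u (hp u _ hu h)
      have := (hn _).1 h
      refine (hn i).2 ?_
      simp at this
      omega
  · intro u hu
    exact Finset.le_sup (f := fun u : List ℕ+ => (u.map PNat.val).sum) (mem_iff_toPartial.2 hu)

lemma mem_wellLabeledForests_iff {ρ τ : ℕ} {h : Hedge}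
    {x : Σ F : Finset (List ℕ+), {u : List ℕ+ // u ∈ F} → ℤ} (e : toPartial x = h.lookup) :
    x ∈ WellLabeledForests ρ τ ↔ TopGood τ h ∧ h.size = ρ + τ + 1 := by
  have hpos : x.1 = h.positions := by
    ext u
    rw [mem_iff_toPartial, mem_positions, e]
  have hmem : ∀ u, u ∈ x.1 ↔ h.lookup u ≠ none := fun u => by rw [mem_iff_toPartial, e]
  rw [← topOK_iff_topGood, ← card_positions, ← hpos, ← e]
  constructor
  · rintro ⟨⟨h0, h1, h2, h3, h4⟩, hc, l1, l2, l3, l4⟩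
    refine ⟨⟨?_, ?_, ?_, ?_, ?_, ?_⟩, hc⟩
    · intro i
      rw [← mem_iff_toPartial, h1]
    · intro i
      simpa [mem_iff_toPartial] using h4 i
    · intro i a ha
      obtain ⟨hu, rfl⟩ := exists_of_toPartial_eq_some ha
      exact l1 _ hu rfl
    · intro i j a ha
      obtain ⟨hu, rfl⟩ := exists_of_toPartial_eq_some ha
      exact l2 _ hu rfl
    · intro u i a b hl ha hb
      obtain ⟨hu, rfl⟩ := exists_of_toPartial_eq_some ha
      obtain ⟨hv, rfl⟩ := exists_of_toPartial_eq_some hb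
      exact l3 u hu hl i hv
    · intro u i j a b hl hij ha hb
      obtain ⟨hu, rfl⟩ := exists_of_toPartial_eq_some ha
      obtain ⟨hv, rfl⟩ := exists_of_toPartial_eq_some hb
      refine l4 u ?_ hl i j hij hu hv
      have := h2 _ hu (by simp; omega)
      simpa using this
  · rintro ⟨H, hc⟩
    refine ⟨⟨?_, ?_, ?_, ?_, ?_⟩, hc, ?_, ?_, ?_, ?_⟩
    · simp [hmem]
    · intro i
      rw [mem_iff_toPartial, H.floors]
    · intro u hu hl
      rcases List.eq_nil_or_concat' u with rfl | ⟨v, i, rfl⟩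
      · simp at hl
      · rw [hmem] at *
        rw [List.dropLast_concat]
        refine lookup_parent h v i ?_ hu
        rintro rfl
        simp at hl
    · intro u _
      obtain ⟨n, hn⟩ := lookup_children h u
      exact ⟨n, fun i => by rw [hmem, hn]⟩
    · intro i
      rw [mem_iff_toPartial, H.last]
      simp
    · intro u hu hl
      obtain ⟨i, rfl⟩ := List.length_eq_one_iff.1 hl
      exact H.floor_label i _ (toPartial_of_mem hu)
    · intro u hu hl
      obtain ⟨i, j, rfl⟩ := List.length_eq_two.1 hl
      exact H.second_label i j _ (toPartial_of_mem hu)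
    · intro u hu hl i hi
      exact H.child u i _ _ hl (toPartial_of_mem hu) (toPartial_of_mem hi)
    · intro u _ hl i j hij hi hj
      exact H.mono u i j _ _ hl hij (toPartial_of_mem hi) (toPartial_of_mem hj)

lemma image_wellLabeledForests (ρ τ : ℕ) :
    toPartial '' WellLabeledForests ρ τ =
      lookup '' {h : Hedge | TopGood τ h ∧ h.size = ρ + τ + 1} := by
  ext f
  constructor
  · rintro ⟨x, hx, rfl⟩
    obtain ⟨h, hh⟩ := exists_lookup_eq_toPartial hx.1
    exact ⟨h, (mem_wellLabeledForests_iff hh.symm).1 hx, hh⟩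
  · rintro ⟨h, hh, rfl⟩
    obtain ⟨x, hx⟩ := exists_toPartial_eq h
    exact ⟨x, (mem_wellLabeledForests_iff hx).2 hh, hx⟩

end Hedge

/-- The number of well-labeled forests with `τ` trees and `ρ+τ+1` elements
satisfies `(4ρ+τ) · |ℱ^ρ_τ| = τ · C(4ρ+τ, ρ)`. -/
theorem card_wellLabeledForests (ρ τ : ℕ) (hτ : 1 ≤ τ) :
    (4 * ρ + τ) * Nat.card ↥(WellLabeledForests ρ τ) =
      τ * Nat.choose (4 * ρ + τ) ρ := by
  rw [← Nat.card_image_of_injective Hedge.toPartial_injective, Hedge.image_wellLabeledForests,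
    Nat.card_image_of_injective Hedge.lookup_injective, Hedge.card_topGood]
end
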